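/- arXiv:2201.04973 — 2 statements merged into one kernel-verified Lean document; each statement's English description precedes it below -/
import Mathlib

section
/- For every l ≥ 2, the Grundy value of the normal-play destined-coins game with equally many light-destined and heavy-destined coins is G(D_{l,l}) = 2l − 2, regardless of which coin is counterfeit. -/
/-!
A model of the counterfeit-coin weighing games.

There are `n` coins, indexed by `Fin n`, exactly one of which is counterfeit;
all genuine coins weigh the same, and the counterfeit is lighter or heavier
than a genuine coin according to its `FakeType`.  Each coin carries a
`CoinStatus` recording the Observer's knowledge about it:

* `excluded`: the Observer knows the coin is genuine;
* `light`   : destined to be lighter (if this coin is the counterfeit, it is lighter);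
* `heavy`   : destined to be heavier (if this coin is the counterfeit, it is heavier);
* `unknown` : the coin could be the counterfeit, either lighter or heavier.

Both players know the counterfeit coin and its type, and alternately perform
weighings: two disjoint sets of coins of equal size are put on the two pans of a
balance scale, and the outcome is determined by the truth.  After a balanced
weighing, the coins on the scale become excluded.  After an unbalanced weighing,
the coins off the scale become excluded; a coin on the lighter pan becomes
light-destined unless this contradicts its previous status (a heavy-destined
coin on the lighter pan becomes excluded); symmetrically for the heavier pan;
excluded coins stay excluded.  A weighing is legal iff the Observer gains some
new information, i.e. some coin changes status.

`Found P` says the Observer has found the counterfeit coin (exactly one coin is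
not excluded); `FoundAndIdentified P` says she has moreover identified it as
lighter or heavier.  In the game whose end condition is a goal `goal`, play
stops as soon as the goal is reached (`GMove goal`).  `NormalWin` is the
normal-play winning predicate for the player to move (the player unable to move
loses, so the player making the last legal weighing wins); `MisereWin` is the
misère-play winning predicate (the player whose weighing reveals the full
information, i.e. moves to a goal position, loses); `grundy` is the Grundy
(nim-)value: the `mex` of the Grundy values of the options, a position without
options having Grundy value `0`.  Since every legal weighing strictly decreases
the total hidden information `info P`, defining these by recursion with fuel
`info P` gives the correct values.
-/

/-- The Observer's knowledge about one coin. -/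
inductive CoinStatus : Type
  | excluded : CoinStatus
  | light    : CoinStatus
  | heavy    : CoinStatus
  | unknown  : CoinStatus
  deriving DecidableEq

/-- Whether the counterfeit coin is actually lighter or heavier than a genuine coin. -/
inductive FakeType : Type
  | light : FakeType
  | heavy : FakeType
  deriving DecidableEq

/-- The destiny status corresponding to the true type of the counterfeit coin. -/
def FakeType.destiny : FakeType → CoinStatus
  | FakeType.light => CoinStatus.light
  | FakeType.heavy => CoinStatus.heavy

/-- A position of the game: the statuses of the coins (the Observer's knowledge)
together with the identity and the true type of the counterfeit coin (which both
players know). -/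
structure Position (n : ℕ) : Type where
  status : Fin n → CoinStatus
  counterfeit : Fin n
  fakeType : FakeType

/-- Possible outcomes of a weighing. -/
inductive Outcome : Type
  | balanced | leftLighter | rightLighter
  deriving DecidableEq

/-- The truthful outcome of weighing pan `A` (left) against pan `B` (right):
it is determined by the location and the type of the counterfeit coin. -/
def outcome {n : ℕ} (P : Position n) (A B : Finset (Fin n)) : Outcome :=
  if P.counterfeit ∈ A then
    (match P.fakeType with
      | FakeType.light => Outcome.leftLighter
      | FakeType.heavy => Outcome.rightLighter)
  else if P.counterfeit ∈ B then
    (match P.fakeType with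
      | FakeType.light => Outcome.rightLighter
      | FakeType.heavy => Outcome.leftLighter)
  else Outcome.balanced

/-- New status of a coin that lay on the lighter pan of an unbalanced weighing. -/
def onLighterPan : CoinStatus → CoinStatus
  | CoinStatus.excluded => CoinStatus.excluded
  | CoinStatus.heavy => CoinStatus.excluded
  | _ => CoinStatus.light

/-- New status of a coin that lay on the heavier pan of an unbalanced weighing. -/
def onHeavierPan : CoinStatus → CoinStatus
  | CoinStatus.excluded => CoinStatus.excluded
  | CoinStatus.light => CoinStatus.excluded
  | _ => CoinStatus.heavy

/-- The statuses after weighing `A` against `B`. -/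
def updateStatus {n : ℕ} (P : Position n) (A B : Finset (Fin n)) (i : Fin n) :
    CoinStatus :=
  match outcome P A B with
  | Outcome.balanced =>
      if i ∈ A ∨ i ∈ B then CoinStatus.excluded else P.status i
  | Outcome.leftLighter =>
      if i ∈ A then onLighterPan (P.status i)
      else if i ∈ B then onHeavierPan (P.status i)
      else CoinStatus.excluded
  | Outcome.rightLighter =>
      if i ∈ B then onLighterPan (P.status i)
      else if i ∈ A then onHeavierPan (P.status i)
      else CoinStatus.excluded

/-- The position obtained from `P` by weighing pan `A` against pan `B`. -/
def weigh {n : ℕ} (P : Position n) (A B : Finset (Fin n)) : Position n :=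
  ⟨updateStatus P A B, P.counterfeit, P.fakeType⟩

/-- `Move P Q`: `Q` is obtained from `P` by one legal weighing, i.e. the two
pans are disjoint and carry equally many coins, and the Observer gains some new
information (some coin changes status). -/
def Move {n : ℕ} (P Q : Position n) : Prop :=
  ∃ A B : Finset (Fin n), Disjoint A B ∧ A.card = B.card ∧
    updateStatus P A B ≠ P.status ∧ Q = weigh P A B

/-- The set of coins currently having status `s`. -/
def statusSet {n : ℕ} (P : Position n) (s : CoinStatus) : Finset (Fin n) :=
  Finset.univ.filter fun i => P.status i = s

/-- The set of coins not yet known to be genuine. -/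
def nonExcluded {n : ℕ} (P : Position n) : Finset (Fin n) :=
  Finset.univ.filter fun i => P.status i ≠ CoinStatus.excluded

/-- The number of unknown coins. -/
def unknownCount {n : ℕ} (P : Position n) : ℕ :=
  (statusSet P CoinStatus.unknown).card

/-- The number of destined coins. -/
def destinedCount {n : ℕ} (P : Position n) : ℕ :=
  (statusSet P CoinStatus.light).card + (statusSet P CoinStatus.heavy).card

/-- The number of coins sharing the counterfeit coin's status, counting the
counterfeit coin itself. -/
def sameDestinyCount {n : ℕ} (P : Position n) : ℕ :=
  (Finset.univ.filter fun i => P.status i = P.status P.counterfeit).card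

/-- The Observer has found the counterfeit coin: exactly one coin is not excluded. -/
def Found {n : ℕ} (P : Position n) : Prop := (nonExcluded P).card = 1

/-- The Observer has found the counterfeit coin and knows whether it is lighter
or heavier. -/
def FoundAndIdentified {n : ℕ} (P : Position n) : Prop :=
  Found P ∧ P.status P.counterfeit ≠ CoinStatus.unknown

/-- Moves in the game whose end condition is `goal`: the game stops as soon as
the Observer's goal is reached, so no further weighings happen after that. -/
def GMove {n : ℕ} (goal : Position n → Prop) (P Q : Position n) : Prop :=
  ¬ goal P ∧ Move P Q

/-- The amount of information about one coin still hidden from the Observer. -/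
def statusWeight : CoinStatus → ℕ
  | CoinStatus.excluded => 0
  | CoinStatus.unknown => 2
  | _ => 1

/-- The total information still hidden from the Observer.  Every legal weighing
strictly decreases it, so it bounds the number of remaining moves. -/
def info {n : ℕ} (P : Position n) : ℕ := ∑ i, statusWeight (P.status i)

/-- Normal-play winning predicate, computed with fuel. -/
def NormalWinAux {n : ℕ} (moveRel : Position n → Position n → Prop) :
    ℕ → Position n → Prop
  | 0, _ => False
  | k + 1, P => ∃ Q, moveRel P Q ∧ ¬ NormalWinAux moveRel k Q

/-- The player to move wins under normal play: a player who has no legal move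
loses (so the player making the last legal weighing wins).  The fuel `info P`
suffices since every legal weighing strictly decreases `info`. -/
def NormalWin {n : ℕ} (moveRel : Position n → Position n → Prop)
    (P : Position n) : Prop :=
  NormalWinAux moveRel (info P) P

/-- Misère-play winning predicate, computed with fuel. -/
def MisereWinAux {n : ℕ} (moveRel : Position n → Position n → Prop)
    (goal : Position n → Prop) : ℕ → Position n → Prop
  | 0, P => goal P
  | k + 1, P => goal P ∨ ∃ Q, moveRel P Q ∧ ¬ MisereWinAux moveRel goal k Q

/-- The player to move wins under misère play: the player whose weighing
reveals the full information to the Observer (i.e. moves to a position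
satisfying `goal`) loses; equivalently, the player to move at a goal position
has already won.  A position is a P-position iff `MisereWin` fails there. -/
def MisereWin {n : ℕ} (moveRel : Position n → Position n → Prop)
    (goal : Position n → Prop) (P : Position n) : Prop :=
  MisereWinAux moveRel goal (info P) P

/-- Minimum excludant of a set of naturals. -/
noncomputable def mex (s : Set ℕ) : ℕ := sInf {k : ℕ | k ∉ s}

/-- Grundy values, computed with fuel. -/
noncomputable def grundyAux {n : ℕ} (moveRel : Position n → Position n → Prop) :
    ℕ → Position n → ℕ
  | 0, _ => 0
  | k + 1, P => mex {g : ℕ | ∃ Q, moveRel P Q ∧ grundyAux moveRel k Q = g}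

/-- The Grundy (nim-)value of a position: the `mex` of the Grundy values of the
positions reachable in one legal move; a position with no legal move has Grundy
value `0`.  The fuel `info P` suffices since every legal weighing strictly
decreases `info`. -/
noncomputable def grundy {n : ℕ} (moveRel : Position n → Position n → Prop)
    (P : Position n) : ℕ :=
  grundyAux moveRel (info P) P

open Finset

/-- Every coin carries a destiny or is excluded, and the counterfeit carries its true destiny. -/
def Destined {n : ℕ} (P : Position n) : Prop :=
  (∀ i, P.status i ≠ CoinStatus.unknown) ∧ P.status P.counterfeit = P.fakeType.destiny

theorem mex_eq {s : Set ℕ} {m : ℕ} (h : ∀ k < m, k ∈ s) (hm : m ∉ s) : mex s = m := by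
  unfold mex
  apply le_antisymm (Nat.sInf_le hm)
  by_contra! hlt
  exact Nat.sInf_mem (s := {k | k ∉ s}) ⟨m, hm⟩ (h _ hlt)

theorem mem_nonExcluded {n : ℕ} {P : Position n} {i : Fin n} :
    i ∈ nonExcluded P ↔ P.status i ≠ CoinStatus.excluded := by
  simp [nonExcluded]

theorem Destined.counterfeit_mem {n : ℕ} {P : Position n} (hP : Destined P) :
    P.counterfeit ∈ nonExcluded P := by
  rw [mem_nonExcluded, hP.2]
  cases P.fakeType <;> simp [FakeType.destiny]

theorem Destined.info_eq {n : ℕ} {P : Position n} (hP : Destined P) :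
    info P = #(nonExcluded P) := by
  rw [info, nonExcluded, card_filter]
  refine sum_congr rfl fun i _ => ?_
  have := hP.1 i
  cases h : P.status i <;> simp_all [statusWeight]

theorem updateStatus_of_notMem {n : ℕ} {P : Position n} {A B : Finset (Fin n)}
    (hA : P.counterfeit ∉ A) (hB : P.counterfeit ∉ B) (i : Fin n) :
    updateStatus P A B i = if i ∈ A ∪ B then CoinStatus.excluded else P.status i := by
  simp [updateStatus, outcome, hA, hB]

theorem updateStatus_swap {n : ℕ} (P : Position n) {A B : Finset (Fin n)} (h : Disjoint A B) :
    updateStatus P A B = updateStatus P B A := by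
  funext i
  have hc : P.counterfeit ∈ A → P.counterfeit ∉ B := fun hA => Finset.disjoint_left.mp h hA
  unfold updateStatus outcome
  by_cases hA : P.counterfeit ∈ A <;> by_cases hB : P.counterfeit ∈ B <;>
    cases P.fakeType <;> simp_all [or_comm]

/-- If the counterfeit is weighed, exactly the coins agreeing with its destiny on its own pan and
the coins of the opposite destiny on the other pan remain candidates. -/
theorem Destined.updateStatus_of_mem {n : ℕ} {P : Position n} (hP : Destined P)
    {A B : Finset (Fin n)} (hAB : Disjoint A B) (hA : P.counterfeit ∈ A) (i : Fin n) :
    updateStatus P A B i =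
      if (i ∈ A ∧ P.status i = P.status P.counterfeit) ∨
        (i ∈ B ∧ P.status i ≠ P.status P.counterfeit) then P.status i
      else CoinStatus.excluded := by
  have hi := hP.1 i
  have hd : i ∈ A → i ∉ B := fun hA => Finset.disjoint_left.mp hAB hA
  rw [hP.2]
  by_cases hiA : i ∈ A <;> by_cases hiB : i ∈ B <;> cases hf : P.fakeType <;>
    cases h : P.status i <;>
    simp_all [updateStatus, outcome, FakeType.destiny, onLighterPan, onHeavierPan]

theorem Destined.updateStatus_eq_or {n : ℕ} {P : Position n} (hP : Destined P)
    {A B : Finset (Fin n)} (hAB : Disjoint A B) (i : Fin n) :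
    updateStatus P A B i = P.status i ∨ updateStatus P A B i = CoinStatus.excluded := by
  by_cases hA : P.counterfeit ∈ A
  · rw [hP.updateStatus_of_mem hAB hA]
    split_ifs <;> simp
  by_cases hB : P.counterfeit ∈ B
  · rw [updateStatus_swap P hAB, hP.updateStatus_of_mem hAB.symm hB]
    split_ifs <;> simp
  · rw [updateStatus_of_notMem hA hB]
    split_ifs <;> simp

theorem Destined.updateStatus_counterfeit {n : ℕ} {P : Position n} (hP : Destined P)
    {A B : Finset (Fin n)} (hAB : Disjoint A B) :
    updateStatus P A B P.counterfeit = P.status P.counterfeit := by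
  by_cases hA : P.counterfeit ∈ A
  · simp [hP.updateStatus_of_mem hAB hA, hA]
  by_cases hB : P.counterfeit ∈ B
  · simp [updateStatus_swap P hAB, hP.updateStatus_of_mem hAB.symm hB, hB]
  · simp [updateStatus_of_notMem hA hB, hA, hB]

theorem Destined.move {n : ℕ} {P Q : Position n} (hP : Destined P) (h : Move P Q) :
    Destined Q ∧ nonExcluded Q ⊂ nonExcluded P := by
  obtain ⟨A, B, hAB, -, hne, rfl⟩ := h
  refine ⟨⟨fun i => ?_, ?_⟩, ?_⟩
  · rcases hP.updateStatus_eq_or hAB i with h | h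
    · simpa [weigh, h] using hP.1 i
    · simp [weigh, h]
  · simpa [weigh, hP.updateStatus_counterfeit hAB] using hP.2
  · obtain ⟨i, hi⟩ := Function.ne_iff.mp hne
    have hex := (hP.updateStatus_eq_or hAB i).resolve_left hi
    refine (ssubset_iff_of_subset fun j hj => ?_).mpr ⟨i, ?_, ?_⟩
    · rw [mem_nonExcluded] at hj ⊢
      rcases hP.updateStatus_eq_or hAB j with h | h
      · simpa [weigh, h] using hj
      · simp [weigh, h] at hj
    · rw [mem_nonExcluded]
      exact fun h => hi (hex.trans h.symm)
    · simp [mem_nonExcluded, weigh, hex]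

/-- A balanced weighing can exclude any even number of coins other than the counterfeit. -/
theorem exists_move_sdiff {n : ℕ} {P : Position n} {T : Finset (Fin n)} (hT : Even #T)
    (hc : P.counterfeit ∉ T) (hne : ∃ i ∈ T, i ∈ nonExcluded P) :
    ∃ Q, Move P Q ∧ nonExcluded Q = nonExcluded P \ T := by
  obtain ⟨k, hk⟩ := hT
  obtain ⟨A, hAT, hA⟩ := exists_subset_card_eq (s := T) (n := k) (by omega)
  have hcA : P.counterfeit ∉ A := fun h => hc (hAT h)
  have hcB : P.counterfeit ∉ T \ A := fun h => hc (mem_sdiff.mp h).1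
  have hst : ∀ i, updateStatus P A (T \ A) i =
      if i ∈ T then CoinStatus.excluded else P.status i := fun i => by
    rw [updateStatus_of_notMem hcA hcB, union_sdiff_of_subset hAT]
  refine ⟨_, ⟨A, T \ A, disjoint_sdiff, ?_, ?_, rfl⟩, ?_⟩
  · rw [card_sdiff_of_subset hAT]
    omega
  · obtain ⟨i, hiT, hi⟩ := hne
    intro h
    have := congrFun h i
    rw [hst, if_pos hiT] at this
    exact mem_nonExcluded.mp hi this.symm
  · ext i
    by_cases hi : i ∈ T <;> simp [mem_nonExcluded, weigh, hst, hi]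

/-- Once some coin is excluded, every smaller positive number of candidates can be reached. -/
theorem Destined.exists_move_card {n : ℕ} {P : Position n} (hP : Destined P)
    {x : Fin n} (hx : x ∉ nonExcluded P) {m : ℕ} (hm : 0 < m) (hlt : m < #(nonExcluded P)) :
    ∃ Q, Move P Q ∧ #(nonExcluded Q) = m := by
  have hc := card_erase_of_mem hP.counterfeit_mem
  obtain ⟨S, hS, hScard⟩ := exists_subset_card_eq
    (s := (nonExcluded P).erase P.counterfeit) (n := #(nonExcluded P) - m) (by omega)
  have hSP : S ⊆ nonExcluded P := hS.trans (erase_subset _ _)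
  have hcS : P.counterfeit ∉ S := fun h => (mem_erase.mp (hS h)).1 rfl
  have hxS : x ∉ S := fun h => hx (hSP h)
  obtain ⟨i, hi⟩ : S.Nonempty := card_pos.mp (by omega)
  have hcx : P.counterfeit ≠ x := fun h => hx (h ▸ hP.counterfeit_mem)
  rcases Nat.even_or_odd #S with he | ho
  · obtain ⟨Q, hQ, hQS⟩ := exists_move_sdiff he hcS ⟨i, hi, hSP hi⟩
    refine ⟨Q, hQ, ?_⟩
    rw [hQS, card_sdiff_of_subset hSP]
    omega
  · obtain ⟨Q, hQ, hQS⟩ := exists_move_sdiff (P := P) (T := insert x S)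
      (by rw [card_insert_of_notMem hxS]; exact ho.add_one)
      (by simp [hcx, hcS]) ⟨i, mem_insert_of_mem hi, hSP hi⟩
    refine ⟨Q, hQ, ?_⟩
    rw [hQS, sdiff_insert_of_notMem hx, card_sdiff_of_subset hSP]
    omega

/-- Once some coin is excluded, the Grundy value is one less than the number of candidates. -/
theorem Destined.grundyAux_eq {n : ℕ} {x : Fin n} (k : ℕ) {P : Position n} (hP : Destined P)
    (hx : x ∉ nonExcluded P) (hk : #(nonExcluded P) ≤ k + 1) :
    grundyAux (GMove Found) k P = #(nonExcluded P) - 1 := by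
  induction k generalizing P with
  | zero => simp only [grundyAux]; omega
  | succ k ih =>
    have hrec : ∀ Q, Move P Q →
        grundyAux (GMove Found) k Q = #(nonExcluded Q) - 1 ∧ 0 < #(nonExcluded Q) ∧
          #(nonExcluded Q) < #(nonExcluded P) := fun Q hQ => by
      obtain ⟨hQd, hss⟩ := hP.move hQ
      have := card_lt_card hss
      exact ⟨ih hQd (fun h => hx (hss.1 h)) (by omega),
        card_pos.mpr ⟨_, hQd.counterfeit_mem⟩, this⟩
    refine mex_eq (fun g hg => ?_) ?_
    · obtain ⟨Q, hQ, hcard⟩ := hP.exists_move_card hx (m := g + 1) (by omega) (by omega)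
      refine ⟨Q, ⟨?_, hQ⟩, ?_⟩
      · unfold Found
        omega
      · rw [(hrec Q hQ).1, hcard]
        omega
    · rintro ⟨Q, ⟨-, hQ⟩, hg⟩
      have := hrec Q hQ
      omega

theorem card_nonExcluded_weigh_of_notMem {n : ℕ} {P : Position n} {A B : Finset (Fin n)}
    (hA : P.counterfeit ∉ A) (hB : P.counterfeit ∉ B) (hAB : Disjoint A B)
    (hU : nonExcluded P = univ) :
    #(nonExcluded (weigh P A B)) + (#A + #B) = n := by
  have : nonExcluded (weigh P A B) = (A ∪ B)ᶜ := by
    ext i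
    have hi : i ∈ nonExcluded P := hU ▸ mem_univ i
    rw [mem_nonExcluded] at hi ⊢
    simp [weigh, updateStatus_of_notMem hA hB, hi]
  rw [this, card_compl, card_union_of_disjoint hAB, Fintype.card_fin]
  have := card_le_univ (A ∪ B)
  rw [card_union_of_disjoint hAB, Fintype.card_fin] at this
  omega

theorem Destined.card_nonExcluded_weigh_of_mem {n : ℕ} {P : Position n} (hP : Destined P)
    {A B : Finset (Fin n)} (hA : P.counterfeit ∈ A) (hAB : Disjoint A B)
    (hU : nonExcluded P = univ) {S : Finset (Fin n)}
    (hS : ∀ i, i ∈ S ↔ P.status i = P.status P.counterfeit) :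
    #(nonExcluded (weigh P A B)) = #(A ∩ S) + #(B \ S) := by
  rw [← card_union_of_disjoint
    (hAB.mono inter_subset_left sdiff_subset)]
  congr 1
  ext i
  have hi : i ∈ nonExcluded P := hU ▸ mem_univ i
  rw [mem_nonExcluded] at hi
  simp only [mem_nonExcluded, weigh, hP.updateStatus_of_mem hAB hA, mem_union, mem_inter,
    mem_sdiff, hS]
  split_ifs with h <;> simp [h, hi]

/-- With equally many coins of both destinies, no weighing excludes exactly one coin. -/
theorem Destined.card_nonExcluded_ne {n l : ℕ} {P Q : Position n} (hP : Destined P)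
    (hU : nonExcluded P = univ) {S : Finset (Fin n)}
    (hS : ∀ i, i ∈ S ↔ P.status i = P.status P.counterfeit)
    (hSl : #S = l) (hSc : #Sᶜ = l) (hn : n = 2 * l) (h : Move P Q) :
    #(nonExcluded Q) + 1 ≠ 2 * l := by
  have key : ∀ A B : Finset (Fin n), Disjoint A B → #A = #B → P.counterfeit ∈ A →
      #(nonExcluded (weigh P A B)) + 1 ≠ 2 * l := fun A B hAB hcard hA => by
    rw [hP.card_nonExcluded_weigh_of_mem hA hAB hU hS]
    have h1 := card_inter_add_card_sdiff A S
    have h2 := card_inter_add_card_sdiff B S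
    have h3 : #(A ∩ S) + #(B ∩ S) ≤ #S := by
      rw [← card_union_of_disjoint (hAB.mono inter_subset_left inter_subset_left)]
      exact card_le_card (union_subset inter_subset_right inter_subset_right)
    have h4 : #(A \ S) + #(B \ S) ≤ #Sᶜ := by
      rw [← card_union_of_disjoint (hAB.mono sdiff_subset sdiff_subset)]
      exact card_le_card fun i => by
        simp only [mem_union, mem_sdiff, mem_compl]
        tauto
    omega
  obtain ⟨A, B, hAB, hcard, -, rfl⟩ := h
  by_cases hA : P.counterfeit ∈ A
  · exact key A B hAB hcard hA
  by_cases hB : P.counterfeit ∈ B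
  · have : weigh P A B = weigh P B A := by simp [weigh, updateStatus_swap P hAB]
    rw [this]
    exact key B A hAB.symm hcard.symm hB
  · have := card_nonExcluded_weigh_of_notMem hA hB hAB hU
    omega

/-- Weighing `r + 1` coins of the counterfeit's destiny against `r` coins of the opposite destiny
and one more coin of the counterfeit's destiny leaves `2 * r + 1` candidates. -/
theorem Destined.exists_move_odd {n : ℕ} {P : Position n} (hP : Destined P)
    (hU : nonExcluded P = univ) {S : Finset (Fin n)}
    (hS : ∀ i, i ∈ S ↔ P.status i = P.status P.counterfeit)
    {r : ℕ} (hr : r + 2 ≤ #S) (hr' : r ≤ #Sᶜ) :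
    ∃ Q, Move P Q ∧ #(nonExcluded Q) = 2 * r + 1 := by
  have hcS : P.counterfeit ∈ S := (hS _).mpr rfl
  obtain ⟨A, hcA, hAS, hA⟩ := exists_subsuperset_card_eq (s := {P.counterfeit}) (t := S)
    (n := r + 1) (by simpa using hcS) (by simp) (by omega)
  replace hcA : P.counterfeit ∈ A := hcA (mem_singleton_self _)
  obtain ⟨y, hyS, hyA⟩ := exists_mem_notMem_of_card_lt_card (s := A) (t := S) (by omega)
  obtain ⟨R, hRS, hR⟩ := exists_subset_card_eq hr'
  have hRS' : ∀ i ∈ R, i ∉ S := fun i hi => mem_compl.mp (hRS hi)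
  have hyR : y ∉ R := fun h => hRS' y h hyS
  have hAB : Disjoint A (insert y R) := by
    rw [disjoint_insert_right]
    exact ⟨hyA, disjoint_left.mpr fun i hi hiR => hRS' i hiR (hAS hi)⟩
  have hcard : #(nonExcluded (weigh P A (insert y R))) = 2 * r + 1 := by
    rw [hP.card_nonExcluded_weigh_of_mem hcA hAB hU hS, inter_eq_left.mpr hAS,
      insert_sdiff_of_mem _ hyS, sdiff_eq_self_of_disjoint (disjoint_left.mpr hRS')]
    omega
  refine ⟨_, ⟨A, insert y R, hAB, ?_, fun h => ?_, rfl⟩, hcard⟩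
  · rw [card_insert_of_notMem hyR]
    omega
  · have : weigh P A (insert y R) = P := by
      rw [weigh, h]
    rw [this, hU, card_univ] at hcard
    have := card_add_card_compl S
    omega

/-- For every `l ≥ 2`, the Grundy value of the normal-play
destined-coins game with equally many light-destined and heavy-destined coins
is `G(D_{l,l}) = 2l - 2`, regardless of which coin is counterfeit. -/
theorem grundy_destined_equal {n l : ℕ} (P : Position n) (hl2 : 2 ≤ l)
    (hl : (statusSet P CoinStatus.light).card = l)
    (hh : (statusSet P CoinStatus.heavy).card = l)
    (hd : ∀ i, P.status i = CoinStatus.light ∨ P.status i = CoinStatus.heavy)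
    (hcf : P.status P.counterfeit = P.fakeType.destiny) :
    grundy (GMove Found) P = 2 * l - 2 := by
  have hP : Destined P := ⟨fun i => by rcases hd i with h | h <;> simp [h], hcf⟩
  have hU : nonExcluded P = univ := by
    ext i
    rcases hd i with h | h <;> simp [mem_nonExcluded, h]
  have hcompl : statusSet P CoinStatus.heavy = (statusSet P CoinStatus.light)ᶜ := by
    ext i
    rcases hd i with h | h <;> simp [statusSet, h]
  have hn : n = 2 * l := by
    have := card_add_card_compl (statusSet P CoinStatus.light)
    rw [← hcompl, Fintype.card_fin] at this
    omega
  obtain ⟨S, hS, hSl, hSc⟩ : ∃ S : Finset (Fin n),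
      (∀ i, i ∈ S ↔ P.status i = P.status P.counterfeit) ∧ #S = l ∧ #Sᶜ = l := by
    rcases hd P.counterfeit with h | h
    · exact ⟨statusSet P CoinStatus.light, fun i => by simp [statusSet, h], hl, hcompl ▸ hh⟩
    · refine ⟨statusSet P CoinStatus.heavy, fun i => by simp [statusSet, h], hh, ?_⟩
      rw [hcompl, compl_compl, hl]
  have hcard : #(nonExcluded P) = 2 * l := by rw [hU, card_univ, Fintype.card_fin, hn]
  obtain ⟨k, hk⟩ : ∃ k, 2 * l = k + 1 := ⟨2 * l - 1, by omega⟩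
  have hrec : ∀ Q, Move P Q →
      grundyAux (GMove Found) k Q = #(nonExcluded Q) - 1 ∧ 0 < #(nonExcluded Q) ∧
        #(nonExcluded Q) < 2 * l := fun Q hQ => by
    obtain ⟨hQd, hss⟩ := hP.move hQ
    have hlt := card_lt_card hss
    obtain ⟨x, -, hx⟩ := exists_of_ssubset hss
    exact ⟨hQd.grundyAux_eq k hx (by omega), card_pos.mpr ⟨_, hQd.counterfeit_mem⟩, by omega⟩
  have hreach : ∀ m, 0 < m → m + 1 < 2 * l → ∃ Q, Move P Q ∧ #(nonExcluded Q) = m := by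
    intro m hm hml
    rcases Nat.even_or_odd' m with ⟨r, rfl | rfl⟩
    · have hc := card_erase_of_mem (mem_univ P.counterfeit)
      rw [card_univ, Fintype.card_fin] at hc
      obtain ⟨T, hT, hTcard⟩ := exists_subset_card_eq
        (s := univ.erase P.counterfeit) (n := 2 * l - 2 * r) (by omega)
      obtain ⟨i, hi⟩ : T.Nonempty := card_pos.mp (by omega)
      obtain ⟨Q, hQ, hQT⟩ := exists_move_sdiff (P := P) (T := T) ⟨l - r, by omega⟩
        (fun h => (mem_erase.mp (hT h)).1 rfl) ⟨i, hi, hU ▸ mem_univ i⟩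
      refine ⟨Q, hQ, ?_⟩
      rw [hQT, card_sdiff_of_subset (hU ▸ subset_univ T)]
      omega
    · exact hP.exists_move_odd hU hS (by omega) (by omega)
  rw [grundy, hP.info_eq, hcard, hk]
  refine mex_eq (fun g hg => ?_) ?_
  · obtain ⟨Q, hQ, hQcard⟩ := hreach (g + 1) (by omega) (by omega)
    refine ⟨Q, ⟨?_, hQ⟩, ?_⟩
    · unfold Found
      omega
    · rw [(hrec Q hQ).1, hQcard]
      omega
  · rintro ⟨Q, ⟨-, hQ⟩, hg⟩
    have := hrec Q hQ
    have := hP.card_nonExcluded_ne hU hS hSl hSc hn hQ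
    omega
end

section
/- For every even N ≥ 4, the normal-play unknown-coins games without an extra coin satisfy G(F_N) = G(FI_N) = 0; that is, both the find game and the find-and-identify game starting from N unknown coins are P-positions (the first player loses under optimal play). -/
lemma mex_eq_zero_of_zero_notMem {s : Set ℕ} (h : 0 ∉ s) : mex s = 0 :=
  Nat.sInf_eq_zero.2 (Or.inl h)

lemma mex_ne_zero_of_zero_mem {s : Set ℕ} (hs : s.Finite) (h : 0 ∈ s) : mex s ≠ 0 := by
  intro h0
  have hne : {k : ℕ | k ∉ s}.Nonempty := hs.infinite_compl.nonempty
  have hmem : mex s ∈ {k : ℕ | k ∉ s} := Nat.sInf_mem hne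
  rw [h0] at hmem
  exact hmem h

lemma finite_grundyAux_options {n : ℕ} (goal : Position n → Prop) (k : ℕ) (P : Position n) :
    {g : ℕ | ∃ Q, GMove goal P Q ∧ grundyAux (GMove goal) k Q = g}.Finite := by
  refine (Set.finite_range fun p : Finset (Fin n) × Finset (Fin n) =>
    grundyAux (GMove goal) k (weigh P p.1 p.2)).subset ?_
  rintro g ⟨Q, ⟨-, A, B, -, -, -, rfl⟩, rfl⟩
  exact ⟨(A, B), rfl⟩

lemma grundyAux_eq_zero_of_goal {n : ℕ} {goal : Position n → Prop} {P : Position n}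
    (h : goal P) (k : ℕ) : grundyAux (GMove goal) k P = 0 := by
  cases k with
  | zero => rfl
  | succ k => exact mex_eq_zero_of_zero_notMem fun ⟨_, hm, _⟩ => hm.1 h

lemma grundyAux_ne_zero_of_move_to_goal {n : ℕ} {goal : Position n → Prop} {P Q : Position n}
    (hm : GMove goal P Q) (hQ : goal Q) (k : ℕ) : grundyAux (GMove goal) (k + 1) P ≠ 0 :=
  mex_ne_zero_of_zero_mem (finite_grundyAux_options goal k P)
    ⟨Q, hm, grundyAux_eq_zero_of_goal hQ k⟩

/-- A position is a P-position if every option can be answered by a move to the goal. -/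
lemma grundy_eq_zero_of_forall_answer {n : ℕ} {goal : Position n → Prop} {P : Position n}
    (hP : 2 ≤ info P)
    (h : ∀ Q, GMove goal P Q → ∃ R, GMove goal Q R ∧ goal R) :
    grundy (GMove goal) P = 0 := by
  obtain ⟨k, hk⟩ : ∃ k, info P = k + 2 := ⟨info P - 2, by omega⟩
  rw [grundy, hk]
  refine mex_eq_zero_of_zero_notMem ?_
  rintro ⟨Q, hQ, h0⟩
  obtain ⟨R, hR, hgoal⟩ := h Q hQ
  exact grundyAux_ne_zero_of_move_to_goal hR hgoal k h0

/-- Weighing the counterfeit coin against a genuine coin that is excluded or has the true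
destiny excludes every other coin. -/
lemma weigh_counterfeit_status {n : ℕ} {Q : Position n} {j : Fin n}
    (hj : j ≠ Q.counterfeit)
    (hc : Q.status Q.counterfeit = CoinStatus.unknown ∨
      Q.status Q.counterfeit = Q.fakeType.destiny)
    (hs : Q.status j = CoinStatus.excluded ∨ Q.status j = Q.fakeType.destiny) (i : Fin n) :
    (weigh Q {Q.counterfeit} {j}).status i =
      if i = Q.counterfeit then Q.fakeType.destiny else CoinStatus.excluded := by
  cases hf : Q.fakeType <;> rw [hf] at hc hs <;>
    by_cases hi : i = Q.counterfeit <;> by_cases hij : i = j <;>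
    simp only [weigh, updateStatus, outcome, hf, Finset.mem_singleton, if_true]
  all_goals first | (subst hi; rcases hc with hc | hc) | skip
  all_goals first | (subst hij; rcases hs with hs | hs) | skip
  all_goals simp_all [FakeType.destiny, onLighterPan, onHeavierPan]

lemma found_and_identified_of_status {n : ℕ} {R : Position n} {s : CoinStatus}
    (hs : s ≠ CoinStatus.excluded) (hu : s ≠ CoinStatus.unknown)
    (h : ∀ i, R.status i = if i = R.counterfeit then s else CoinStatus.excluded) :
    FoundAndIdentified R := by
  refine ⟨Finset.card_eq_one.2 ⟨R.counterfeit, ?_⟩, by simp [h, hu]⟩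
  ext i
  by_cases hi : i = R.counterfeit <;> simp [nonExcluded, h, hi, hs]

/-- From a position where the counterfeit coin is not yet found, it can be identified in one
weighing if a suitable genuine coin is available. -/
lemma exists_move_foundAndIdentified {n : ℕ} {Q : Position n} {j : Fin n}
    (hQ : ¬ Found Q) (hj : j ≠ Q.counterfeit)
    (hc : Q.status Q.counterfeit = CoinStatus.unknown ∨
      Q.status Q.counterfeit = Q.fakeType.destiny)
    (hs : Q.status j = CoinStatus.excluded ∨ Q.status j = Q.fakeType.destiny) :
    ∃ R, Move Q R ∧ FoundAndIdentified R := by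
  have hR : FoundAndIdentified (weigh Q {Q.counterfeit} {j}) :=
    found_and_identified_of_status (s := Q.fakeType.destiny)
      (by cases Q.fakeType <;> simp [FakeType.destiny])
      (by cases Q.fakeType <;> simp [FakeType.destiny])
      (weigh_counterfeit_status hj hc hs)
  refine ⟨_, ⟨_, _, Finset.disjoint_singleton.2 hj.symm, rfl, fun heq => hQ ?_, rfl⟩, hR⟩
  have hfound := hR.1
  simp only [Found, nonExcluded, weigh, heq] at hfound
  exact hfound

/-- A weighing of unknown coins with the counterfeit coin off the scale excludes exactly the
weighed coins. -/
lemma weigh_status_of_balanced {n : ℕ} {P : Position n} {A B : Finset (Fin n)}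
    (hall : ∀ i, P.status i = CoinStatus.unknown)
    (hA : P.counterfeit ∉ A) (hB : P.counterfeit ∉ B) (i : Fin n) :
    (weigh P A B).status i =
      if i ∈ A ∪ B then CoinStatus.excluded else CoinStatus.unknown := by
  simp [weigh, updateStatus, outcome, hA, hB, hall]

/-- A weighing of unknown coins with the counterfeit coin on the scale: the unweighed coins are
excluded, the coins on the pan of the counterfeit get its destiny, and no weighed coin is
excluded. -/
lemma weigh_status_of_unbalanced {n : ℕ} {P : Position n} {A B : Finset (Fin n)}
    (hall : ∀ i, P.status i = CoinStatus.unknown) (hAB : Disjoint A B)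
    (hc : P.counterfeit ∈ A ∪ B) (i : Fin n) :
    ((weigh P A B).status i = CoinStatus.excluded ↔ i ∉ A ∪ B) ∧
    (P.counterfeit ∈ A → i ∈ A → (weigh P A B).status i = P.fakeType.destiny) ∧
    (P.counterfeit ∈ B → i ∈ B → (weigh P A B).status i = P.fakeType.destiny) := by
  have hd := Finset.disjoint_left.1 hAB
  have hci := @hd P.counterfeit
  have hii := @hd i
  cases hf : P.fakeType <;> by_cases hA : P.counterfeit ∈ A <;>
    by_cases hB : P.counterfeit ∈ B <;> by_cases hiA : i ∈ A <;> by_cases hiB : i ∈ B <;>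
    simp_all [weigh, updateStatus, outcome, FakeType.destiny, onLighterPan, onHeavierPan]

lemma even_card_union {n : ℕ} {A B : Finset (Fin n)} (hAB : Disjoint A B)
    (hcard : A.card = B.card) : Even (A ∪ B).card := by
  rw [Finset.card_union_of_disjoint hAB, hcard]
  exact ⟨_, rfl⟩

/-- After a legal weighing of an even number `n ≥ 4` of unknown coins, the counterfeit coin is
not found, but can be found and identified by the next weighing. -/
lemma answer_of_all_unknown {n : ℕ} {P Q : Position n}
    (hN : 4 ≤ n) (hn : Even n) (hall : ∀ i, P.status i = CoinStatus.unknown)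
    (hPQ : Move P Q) : ¬ Found Q ∧ ∃ R, Move Q R ∧ FoundAndIdentified R := by
  obtain ⟨A, B, hAB, hcard, hne, rfl⟩ := hPQ
  have heven := even_card_union hAB hcard
  by_cases hc : P.counterfeit ∈ A ∪ B
  · have hst := weigh_status_of_unbalanced hall hAB hc
    have hnf : ¬ Found (weigh P A B) := by
      have : nonExcluded (weigh P A B) = A ∪ B := by
        ext i
        simp only [nonExcluded, Finset.mem_filter_univ, ne_eq, (hst i).1, not_not]
      intro h
      rw [Found, this] at h
      rw [h] at heven
      exact Nat.not_even_one heven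
    have hcd : (weigh P A B).status P.counterfeit = P.fakeType.destiny :=
      (Finset.mem_union.1 hc).elim (fun h => (hst _).2.1 h h) (fun h => (hst _).2.2 h h)
    refine ⟨hnf, ?_⟩
    suffices ∃ j, j ≠ P.counterfeit ∧ ((weigh P A B).status j = CoinStatus.excluded ∨
        (weigh P A B).status j = P.fakeType.destiny) by
      obtain ⟨j, hj, hs⟩ := this
      exact exists_move_foundAndIdentified hnf hj (Or.inr hcd) hs
    by_cases hoff : ∃ j, j ∉ A ∪ B
    · obtain ⟨j, hj⟩ := hoff
      exact ⟨j, fun h => hj (h ▸ hc), Or.inl ((hst j).1.2 hj)⟩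
    · push Not at hoff
      have htotal : A.card + B.card = n := by
        rw [← Finset.card_union_of_disjoint hAB, Finset.eq_univ_iff_forall.2 hoff,
          Finset.card_univ, Fintype.card_fin]
      rcases Finset.mem_union.1 hc with h | h
      · obtain ⟨j, hj, hjc⟩ :=
          Finset.exists_mem_ne (show 1 < A.card by omega) P.counterfeit
        exact ⟨j, hjc, Or.inr ((hst j).2.1 h hj)⟩
      · obtain ⟨j, hj, hjc⟩ :=
          Finset.exists_mem_ne (show 1 < B.card by omega) P.counterfeit
        exact ⟨j, hjc, Or.inr ((hst j).2.2 h hj)⟩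
  · have hst := weigh_status_of_balanced hall (fun h => hc (Finset.mem_union_left _ h))
      (fun h => hc (Finset.mem_union_right _ h))
    have hnf : ¬ Found (weigh P A B) := by
      have hset : nonExcluded (weigh P A B) = (A ∪ B)ᶜ := by
        ext i
        by_cases hi : i ∈ A ∪ B <;>
          simp only [nonExcluded, Finset.mem_filter_univ, hst, hi, Finset.mem_compl] <;> simp
      intro h
      rw [Found, hset, Finset.card_compl, Fintype.card_fin] at h
      rw [Nat.even_iff] at heven hn
      omega
    obtain ⟨j, hj⟩ : ∃ j, j ∈ A ∪ B := by
      by_contra! hempty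
      refine hne (funext fun i => ?_)
      exact (hst i).trans (by rw [if_neg (hempty i), hall])
    refine ⟨hnf, exists_move_foundAndIdentified (j := j) hnf (fun h => hc (h ▸ hj)) (Or.inl ?_)
      (Or.inl ?_)⟩
    · exact (hst _).trans (if_neg hc)
    · exact (hst j).trans (if_pos hj)

lemma grundy_all_unknown_eq_zero {n : ℕ} {goal : Position n → Prop} {P : Position n}
    (hfound : ∀ Q, goal Q → Found Q) (hgoal : ∀ Q, FoundAndIdentified Q → goal Q)
    (hN : 4 ≤ n) (hn : Even n) (hall : ∀ i, P.status i = CoinStatus.unknown) :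
    grundy (GMove goal) P = 0 := by
  refine grundy_eq_zero_of_forall_answer ?_ fun Q hQ => ?_
  · simp only [info, hall, statusWeight, Finset.sum_const, Finset.card_univ, Fintype.card_fin,
      smul_eq_mul]
    omega
  · obtain ⟨hnf, R, hR, hid⟩ := answer_of_all_unknown hN hn hall hQ.2
    exact ⟨R, ⟨fun h => hnf (hfound Q h), hR⟩, hgoal R hid⟩

/-- For every even `N ≥ 4`, the normal-play unknown-coins
games without an extra coin satisfy `G(F_N) = G(FI_N) = 0`: both the find game
and the find-and-identify game starting from `N` unknown coins are P-positions
(the first player loses under optimal play). -/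
theorem grundy_unknown_even_normal {n : ℕ} (P : Position n)
    (hN : 4 ≤ n) (hn : Even n)
    (hall : ∀ i, P.status i = CoinStatus.unknown) :
    grundy (GMove Found) P = 0 ∧ grundy (GMove FoundAndIdentified) P = 0 := by
  exact ⟨grundy_all_unknown_eq_zero (fun _ h => h) (fun _ h => h.1) hN hn hall,
    grundy_all_unknown_eq_zero (fun _ h => h.1) (fun _ h => h) hN hn hall⟩
end
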